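/- (Uniqueness theorem.) Assume (A1): f,g:[0,1]×ℝ²→ℝ are continuous and there exist L₁,L₂>0 with |f(t,x₁,y₁)−f(t,x₂,y₂)| ≤ L₁(|x₁−x₂|+|y₁−y₂|) and |g(t,x₁,y₁)−g(t,x₂,y₂)| ≤ L₂(|x₁−x₂|+|y₁−y₂|) for all t∈[0,1] and x₁,x₂,y₁,y₂∈ℝ. Set γ₃ = (L₁/Γ(α+1))[(ψ(1)−ψ(0))^α + ((λ+1)/|Δ₁|)(ψ(1)−ψ(0))^{α+1}] and γ₄ = (L₂/Γ(β+1))[(ψ(1)−ψ(0))^β + ((μ+1)/|Δ₂|)(ψ(1)−ψ(0))^{β+1}]. If γ₃+γ₄ < 1, then there exists exactly one pair of continuous functions x,y:[0,1]→ℝ satisfying x(t) = T₁(x,y)(t) and y(t) = T₂(x,y)(t) for all t∈[0,1]. -/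

import Mathlib

open MeasureTheory intervalIntegral Set

/-- The sup norm of a function on `[0,1]`. -/
noncomputable def supNorm (x : ℝ → ℝ) : ℝ := ⨆ t : Set.Icc (0:ℝ) 1, |x ↑t|

/-- The operator `T₁` (and, with the parameters `(β, ξ, μ, Δ₂, g)`, the operator `T₂`)
associated with the four-point boundary value problem:
`T₁(x,y)(t) = (1/Γ(α)) ∫₀ᵗ ψ'(s)(ψ(t)−ψ(s))^{α−1} f(s,x(s),y(s)) ds
  + (1/Δ₁)[ (1/Γ(α)) ∫₀¹ ψ'(s)(ψ(1)−ψ(s))^{α−1} f(s,x(s),y(s)) ds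
  − (λ/Γ(α)) ∫₀^η ψ'(s)(ψ(η)−ψ(s))^{α−1} f(s,x(s),y(s)) ds ] (ψ(t)−ψ(0))`. -/
noncomputable def Tmap (ψ : ℝ → ℝ) (α η lam Δ : ℝ) (f : ℝ → ℝ → ℝ → ℝ)
    (x y : ℝ → ℝ) (t : ℝ) : ℝ :=
  (1 / Real.Gamma α) * (∫ s in (0:ℝ)..t, deriv ψ s * (ψ t - ψ s) ^ (α - 1) * f s (x s) (y s))
  + (1 / Δ) *
      ((1 / Real.Gamma α) *
          (∫ s in (0:ℝ)..1, deriv ψ s * (ψ 1 - ψ s) ^ (α - 1) * f s (x s) (y s))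
        - (lam / Real.Gamma α) *
          (∫ s in (0:ℝ)..η, deriv ψ s * (ψ η - ψ s) ^ (α - 1) * f s (x s) (y s)))
    * (ψ t - ψ 0)

/-- The fractional integral of `h` with respect to `ψ`, up to the factor `1 / Γ(α)`. -/
noncomputable def psiIntegral (ψ : ℝ → ℝ) (α : ℝ) (h : ℝ → ℝ) (t : ℝ) : ℝ :=
  ∫ s in (0:ℝ)..t, deriv ψ s * (ψ t - ψ s) ^ (α - 1) * h s

lemma Tmap_eq_psiIntegral (ψ : ℝ → ℝ) (α η lam Δ : ℝ) (f : ℝ → ℝ → ℝ → ℝ) (x y : ℝ → ℝ) (t : ℝ) :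
    Tmap ψ α η lam Δ f x y t =
      (1 / Real.Gamma α) * psiIntegral ψ α (fun s => f s (x s) (y s)) t
      + (1 / Δ) * ((1 / Real.Gamma α) * psiIntegral ψ α (fun s => f s (x s) (y s)) 1
        - (lam / Real.Gamma α) * psiIntegral ψ α (fun s => f s (x s) (y s)) η)
      * (ψ t - ψ 0) := rfl

section

variable {ψ : ℝ → ℝ} {α : ℝ}

lemma hasDerivAt_of_deriv_ne (hψ' : ∀ t ∈ Icc (0:ℝ) 1, deriv ψ t ≠ 0) {t : ℝ}
    (ht : t ∈ Icc (0:ℝ) 1) : HasDerivAt ψ (deriv ψ t) t :=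
  (differentiableAt_of_deriv_ne_zero (hψ' t ht)).hasDerivAt

lemma derivWithin_eq_deriv_of_ne (hψ' : ∀ t ∈ Icc (0:ℝ) 1, deriv ψ t ≠ 0) {t : ℝ}
    (ht : t ∈ Icc (0:ℝ) 1) : derivWithin ψ (Icc 0 1) t = deriv ψ t :=
  (hasDerivAt_of_deriv_ne hψ' ht).hasDerivWithinAt.derivWithin
    (uniqueDiffOn_Icc zero_lt_one t ht)

lemma continuousOn_deriv_of_ne (hψC1 : ContDiffOn ℝ 1 ψ (Icc 0 1))
    (hψ' : ∀ t ∈ Icc (0:ℝ) 1, deriv ψ t ≠ 0) : ContinuousOn (deriv ψ) (Icc 0 1) :=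
  (hψC1.continuousOn_derivWithin (uniqueDiffOn_Icc zero_lt_one) le_rfl).congr
    fun _ ht => (derivWithin_eq_deriv_of_ne hψ' ht).symm

lemma deriv_nonneg_of_strictMonoOn (hψmono : StrictMonoOn ψ (Icc 0 1))
    (hψ' : ∀ t ∈ Icc (0:ℝ) 1, deriv ψ t ≠ 0) {t : ℝ} (ht : t ∈ Icc (0:ℝ) 1) :
    0 ≤ deriv ψ t := by
  rw [← derivWithin_eq_deriv_of_ne hψ' ht]
  exact hψmono.monotoneOn.derivWithin_nonneg

lemma continuousOn_kernel (hψC1 : ContDiffOn ℝ 1 ψ (Icc 0 1))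
    (hψ' : ∀ t ∈ Icc (0:ℝ) 1, deriv ψ t ≠ 0) (hα : 1 < α) (t : ℝ) :
    ContinuousOn (fun s => deriv ψ s * (ψ t - ψ s) ^ (α - 1)) (Icc 0 1) :=
  (continuousOn_deriv_of_ne hψC1 hψ').mul
    ((Real.continuous_rpow_const (by linarith)).comp_continuousOn
      (continuousOn_const.sub hψC1.continuousOn))

lemma uIcc_zero_subset {t : ℝ} (ht : t ∈ Icc (0:ℝ) 1) : uIcc 0 t ⊆ Icc (0:ℝ) 1 := by
  rw [uIcc_of_le ht.1]
  exact Icc_subset_Icc_right ht.2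

lemma intervalIntegrable_kernel_mul (hψC1 : ContDiffOn ℝ 1 ψ (Icc 0 1))
    (hψ' : ∀ t ∈ Icc (0:ℝ) 1, deriv ψ t ≠ 0) (hα : 1 < α) {h : ℝ → ℝ}
    (hh : ContinuousOn h (Icc 0 1)) {t : ℝ} (ht : t ∈ Icc (0:ℝ) 1) :
    IntervalIntegrable (fun s => deriv ψ s * (ψ t - ψ s) ^ (α - 1) * h s) volume 0 t :=
  (((continuousOn_kernel hψC1 hψ' hα t).mul hh).mono (uIcc_zero_subset ht)).intervalIntegrable

lemma integral_kernel (hψC1 : ContDiffOn ℝ 1 ψ (Icc 0 1))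
    (hψ' : ∀ t ∈ Icc (0:ℝ) 1, deriv ψ t ≠ 0) (hα : 1 < α) {t : ℝ} (ht : t ∈ Icc (0:ℝ) 1) :
    ∫ s in (0:ℝ)..t, deriv ψ s * (ψ t - ψ s) ^ (α - 1) = (ψ t - ψ 0) ^ α / α := by
  have hα0 : α ≠ 0 := by linarith
  rw [integral_eq_sub_of_hasDerivAt (f := fun s => -((ψ t - ψ s) ^ α / α))]
  · simp [Real.zero_rpow hα0]
  · intro s hs
    have hd := (((hasDerivAt_of_deriv_ne hψ' (uIcc_zero_subset ht hs)).const_sub (ψ t)).rpow_const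
      (p := α) (Or.inr hα.le)).div_const α |>.neg
    exact hd.congr_deriv (by field_simp)
  · exact ((continuousOn_kernel hψC1 hψ' hα t).mono (uIcc_zero_subset ht)).intervalIntegrable

lemma psiIntegral_sub (hψC1 : ContDiffOn ℝ 1 ψ (Icc 0 1))
    (hψ' : ∀ t ∈ Icc (0:ℝ) 1, deriv ψ t ≠ 0) (hα : 1 < α) {h k : ℝ → ℝ}
    (hh : ContinuousOn h (Icc 0 1)) (hk : ContinuousOn k (Icc 0 1)) {t : ℝ}
    (ht : t ∈ Icc (0:ℝ) 1) :
    psiIntegral ψ α h t - psiIntegral ψ α k t = psiIntegral ψ α (fun s => h s - k s) t := by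
  unfold psiIntegral
  rw [← integral_sub (intervalIntegrable_kernel_mul hψC1 hψ' hα hh ht)
    (intervalIntegrable_kernel_mul hψC1 hψ' hα hk ht)]
  simp only [mul_sub]

lemma abs_psiIntegral_le (hψmono : StrictMonoOn ψ (Icc 0 1)) (hψC1 : ContDiffOn ℝ 1 ψ (Icc 0 1))
    (hψ' : ∀ t ∈ Icc (0:ℝ) 1, deriv ψ t ≠ 0) (hα : 1 < α) {h : ℝ → ℝ} {M : ℝ} (hM0 : 0 ≤ M)
    (hM : ∀ s ∈ Icc (0:ℝ) 1, |h s| ≤ M) {t : ℝ} (ht : t ∈ Icc (0:ℝ) 1) :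
    |psiIntegral ψ α h t| ≤ M * ((ψ 1 - ψ 0) ^ α / α) := by
  have hmono := hψmono.monotoneOn
  have h0 : (0:ℝ) ∈ Icc (0:ℝ) 1 := by simp
  have h1 : (1:ℝ) ∈ Icc (0:ℝ) 1 := by simp
  calc |psiIntegral ψ α h t|
      ≤ ∫ s in (0:ℝ)..t, deriv ψ s * (ψ t - ψ s) ^ (α - 1) * M := by
        rw [← Real.norm_eq_abs]
        refine norm_integral_le_of_norm_le ht.1 (Filter.Eventually.of_forall fun s hs => ?_)
          (intervalIntegrable_kernel_mul hψC1 hψ' hα continuousOn_const ht)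
        have hs1 : s ∈ Icc (0:ℝ) 1 := ⟨hs.1.le, hs.2.trans ht.2⟩
        have hk : 0 ≤ deriv ψ s * (ψ t - ψ s) ^ (α - 1) :=
          mul_nonneg (deriv_nonneg_of_strictMonoOn hψmono hψ' hs1)
            (Real.rpow_nonneg (sub_nonneg.2 (hmono hs1 ht hs.2)) _)
        rw [Real.norm_eq_abs, abs_mul, abs_of_nonneg hk]
        exact mul_le_mul_of_nonneg_left (hM s hs1) hk
    _ = M * ((ψ t - ψ 0) ^ α / α) := by
        rw [intervalIntegral.integral_mul_const, integral_kernel hψC1 hψ' hα ht, mul_comm]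
    _ ≤ M * ((ψ 1 - ψ 0) ^ α / α) := by
        have := hmono h0 ht ht.1
        have := hmono ht h1 ht.2
        gcongr

lemma continuousOn_psiIntegral (hψC1 : ContDiffOn ℝ 1 ψ (Icc 0 1))
    (hψ' : ∀ t ∈ Icc (0:ℝ) 1, deriv ψ t ≠ 0) (hα : 1 < α) {h : ℝ → ℝ}
    (hh : ContinuousOn h (Icc 0 1)) : ContinuousOn (psiIntegral ψ α h) (Icc 0 1) := by
  let p : ℝ → ℝ := fun s => (projIcc 0 1 zero_le_one s : ℝ)
  have hp : Continuous p := continuous_subtype_val.comp continuous_projIcc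
  have hpm : ∀ s, p s ∈ Icc (0:ℝ) 1 := fun s => (projIcc 0 1 zero_le_one s).2
  have hpe : ∀ s ∈ Icc (0:ℝ) 1, p s = s := fun s hs => by
    simp [p, projIcc_of_mem zero_le_one hs]
  have hψc : Continuous fun s => ψ (p s) := hψC1.continuousOn.comp_continuous hp hpm
  have hdc : Continuous fun s => deriv ψ (p s) :=
    (continuousOn_deriv_of_ne hψC1 hψ').comp_continuous hp hpm
  have hhc : Continuous fun s => h (p s) := hh.comp_continuous hp hpm
  have hrp := Real.continuous_rpow_const (q := α - 1) (by linarith)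
  have key : Continuous fun t : ℝ =>
      ∫ s in (0:ℝ)..t, deriv ψ (p s) * (ψ (p t) - ψ (p s)) ^ (α - 1) * h (p s) := by
    refine continuous_parametric_intervalIntegral_of_continuous
      (f := fun t s => deriv ψ (p s) * (ψ (p t) - ψ (p s)) ^ (α - 1) * h (p s)) ?_ continuous_id
    exact ((hdc.comp continuous_snd).mul (hrp.comp ((hψc.comp continuous_fst).sub
      (hψc.comp continuous_snd)))).mul (hhc.comp continuous_snd)
  refine key.continuousOn.congr fun t ht => ?_
  refine integral_congr fun s hs => ?_
  simp only [hpe t ht, hpe s (uIcc_zero_subset ht hs)]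

variable {η lam Δ : ℝ} {f : ℝ → ℝ → ℝ → ℝ}

lemma continuousOn_comp_pair
    (hfc : ContinuousOn (fun p : ℝ × ℝ × ℝ => f p.1 p.2.1 p.2.2)
      (Icc 0 1 ×ˢ (univ : Set (ℝ × ℝ)))) {x y : ℝ → ℝ}
    (hx : ContinuousOn x (Icc 0 1)) (hy : ContinuousOn y (Icc 0 1)) :
    ContinuousOn (fun s => f s (x s) (y s)) (Icc 0 1) :=
  hfc.comp (continuousOn_id.prodMk (hx.prodMk hy)) fun _ hs => ⟨hs, mem_univ _⟩

lemma continuousOn_Tmap (hψC1 : ContDiffOn ℝ 1 ψ (Icc 0 1))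
    (hψ' : ∀ t ∈ Icc (0:ℝ) 1, deriv ψ t ≠ 0) (hα : 1 < α)
    (hfc : ContinuousOn (fun p : ℝ × ℝ × ℝ => f p.1 p.2.1 p.2.2)
      (Icc 0 1 ×ˢ (univ : Set (ℝ × ℝ)))) {x y : ℝ → ℝ}
    (hx : ContinuousOn x (Icc 0 1)) (hy : ContinuousOn y (Icc 0 1)) :
    ContinuousOn (Tmap ψ α η lam Δ f x y) (Icc 0 1) :=
  (continuousOn_const.mul
    (continuousOn_psiIntegral hψC1 hψ' hα (continuousOn_comp_pair hfc hx hy))).add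
    (continuousOn_const.mul (hψC1.continuousOn.sub continuousOn_const))

lemma Tmap_congr (hη : η ∈ Icc (0:ℝ) 1) {x y x' y' : ℝ → ℝ} (hx : EqOn x x' (Icc 0 1))
    (hy : EqOn y y' (Icc 0 1)) {t : ℝ} (ht : t ∈ Icc (0:ℝ) 1) :
    Tmap ψ α η lam Δ f x y t = Tmap ψ α η lam Δ f x' y' t := by
  have key : ∀ t ∈ Icc (0:ℝ) 1, psiIntegral ψ α (fun s => f s (x s) (y s)) t =
      psiIntegral ψ α (fun s => f s (x' s) (y' s)) t := fun t ht =>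
    integral_congr fun s hs => by
      simp only [hx (uIcc_zero_subset ht hs), hy (uIcc_zero_subset ht hs)]
  rw [Tmap_eq_psiIntegral, Tmap_eq_psiIntegral, key t ht, key η hη, key 1 (by simp)]

lemma abs_Tmap_sub_le (hψmono : StrictMonoOn ψ (Icc 0 1)) (hψC1 : ContDiffOn ℝ 1 ψ (Icc 0 1))
    (hψ' : ∀ t ∈ Icc (0:ℝ) 1, deriv ψ t ≠ 0) (hα : 1 < α) (hη : η ∈ Icc (0:ℝ) 1)
    (hlam : 0 < lam)
    (hfc : ContinuousOn (fun p : ℝ × ℝ × ℝ => f p.1 p.2.1 p.2.2)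
      (Icc 0 1 ×ˢ (univ : Set (ℝ × ℝ)))) {L : ℝ} (hL : 0 < L)
    (hflip : ∀ t ∈ Icc (0:ℝ) 1, ∀ x₁ y₁ x₂ y₂ : ℝ,
      |f t x₁ y₁ - f t x₂ y₂| ≤ L * (|x₁ - x₂| + |y₁ - y₂|)) {x y x' y' : ℝ → ℝ}
    (hx : ContinuousOn x (Icc 0 1)) (hy : ContinuousOn y (Icc 0 1))
    (hx' : ContinuousOn x' (Icc 0 1)) (hy' : ContinuousOn y' (Icc 0 1)) {D : ℝ}
    (hD : ∀ s ∈ Icc (0:ℝ) 1, |x s - x' s| + |y s - y' s| ≤ D) {t : ℝ} (ht : t ∈ Icc (0:ℝ) 1) :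
    |Tmap ψ α η lam Δ f x y t - Tmap ψ α η lam Δ f x' y' t| ≤
      (L / Real.Gamma (α + 1)) *
        ((ψ 1 - ψ 0) ^ α + ((lam + 1) / |Δ|) * (ψ 1 - ψ 0) ^ (α + 1)) * D := by
  have h0 : (0:ℝ) ∈ Icc (0:ℝ) 1 := by simp
  have h1 : (1:ℝ) ∈ Icc (0:ℝ) 1 := by simp
  have hD0 : 0 ≤ D := le_trans (by positivity) (hD 0 h0)
  have hα0 : 0 < α := by linarith
  have hΓ : 0 < Real.Gamma α := Real.Gamma_pos_of_pos hα0
  have hψ01 : 0 < ψ 1 - ψ 0 := sub_pos.2 (hψmono h0 h1 one_pos)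
  have hψt0 : 0 ≤ ψ t - ψ 0 := sub_nonneg.2 (hψmono.monotoneOn h0 ht ht.1)
  have hψt1 : ψ t - ψ 0 ≤ ψ 1 - ψ 0 := sub_le_sub_right (hψmono.monotoneOn ht h1 ht.2) _
  have hdiff : ∀ s ∈ Icc (0:ℝ) 1, |psiIntegral ψ α (fun s => f s (x s) (y s)) s
      - psiIntegral ψ α (fun s => f s (x' s) (y' s)) s| ≤
      L * D * ((ψ 1 - ψ 0) ^ α / α) := by
    intro s hs
    rw [psiIntegral_sub hψC1 hψ' hα (continuousOn_comp_pair hfc hx hy)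
      (continuousOn_comp_pair hfc hx' hy') hs]
    exact abs_psiIntegral_le hψmono hψC1 hψ' hα (by positivity)
      (fun r hr => (hflip r hr _ _ _ _).trans (mul_le_mul_of_nonneg_left (hD r hr) hL.le)) hs
  have at_t := hdiff t ht
  have at_one := hdiff 1 h1
  have at_eta := hdiff η hη
  rw [Tmap_eq_psiIntegral, Tmap_eq_psiIntegral]
  generalize psiIntegral ψ α (fun s => f s (x s) (y s)) = u at *
  generalize psiIntegral ψ α (fun s => f s (x' s) (y' s)) = v at *
  rw [Real.Gamma_add_one hα0.ne', Real.rpow_add_one hψ01.ne']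
  generalize (ψ 1 - ψ 0) ^ α = P at *
  set B := L * D * (P / α) with hB
  have hB0 : 0 ≤ B := (abs_nonneg _).trans at_t
  have hsplit : 1 / Real.Gamma α * u t
        + 1 / Δ * (1 / Real.Gamma α * u 1 - lam / Real.Gamma α * u η) * (ψ t - ψ 0)
      - (1 / Real.Gamma α * v t
        + 1 / Δ * (1 / Real.Gamma α * v 1 - lam / Real.Gamma α * v η) * (ψ t - ψ 0)) =
      1 / Real.Gamma α * ((u t - v t)
        + 1 / Δ * ((u 1 - v 1) - lam * (u η - v η)) * (ψ t - ψ 0)) := by ring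
  have hinner : |(u 1 - v 1) - lam * (u η - v η)| ≤ (lam + 1) * B :=
    calc _ ≤ |u 1 - v 1| + |lam * (u η - v η)| := abs_sub _ _
      _ = |u 1 - v 1| + lam * |u η - v η| := by rw [abs_mul, abs_of_pos hlam]
      _ ≤ B + lam * B := by gcongr
      _ = (lam + 1) * B := by ring
  rw [hsplit, abs_mul, abs_of_pos (one_div_pos.2 hΓ)]
  calc 1 / Real.Gamma α * |(u t - v t)
        + 1 / Δ * ((u 1 - v 1) - lam * (u η - v η)) * (ψ t - ψ 0)|
      ≤ 1 / Real.Gamma α * (B + 1 / |Δ| * ((lam + 1) * B) * (ψ 1 - ψ 0)) := by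
        gcongr
        refine (abs_add_le _ _).trans ?_
        rw [abs_mul, abs_mul, abs_of_nonneg hψt0, abs_div, abs_one]
        gcongr
    _ = _ := by
        rw [hB]
        have := hΓ.ne'
        field_simp

end

/-- **Uniqueness theorem (Theorem 3.1 of the paper).**
Under (A1), if `γ₃ + γ₄ < 1` then the coupled four-point boundary value problem has a
unique solution on `[0,1]`, i.e. there is exactly one pair of continuous functions
`x, y : [0,1] → ℝ` with `x = T₁(x,y)` and `y = T₂(x,y)` on `[0,1]`. -/
theorem unique_solution_of_coupled_system
    (α β η ξ lam μ Δ₁ Δ₂ : ℝ) (ψ : ℝ → ℝ) (f g : ℝ → ℝ → ℝ → ℝ)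
    (hψmono : StrictMonoOn ψ (Icc 0 1))
    (hψC1 : ContDiffOn ℝ 1 ψ (Icc 0 1))
    (hψ' : ∀ t ∈ Icc (0:ℝ) 1, deriv ψ t ≠ 0)
    (hα1 : 1 < α) (hα2 : α < 2) (hβ1 : 1 < β) (hβ2 : β < 2)
    (hη0 : 0 < η) (hη1 : η < 1) (hξ0 : 0 < ξ) (hξ1 : ξ < 1)
    (hlam : 0 < lam) (hμ : 0 < μ)
    (hΔ₁ : Δ₁ = lam * (ψ η - ψ 0) - (ψ 1 - ψ 0)) (hΔ₁0 : Δ₁ ≠ 0)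
    (hΔ₂ : Δ₂ = μ * (ψ ξ - ψ 0) - (ψ 1 - ψ 0)) (hΔ₂0 : Δ₂ ≠ 0)
    (hfc : ContinuousOn (fun p : ℝ × ℝ × ℝ => f p.1 p.2.1 p.2.2)
      (Icc 0 1 ×ˢ (univ : Set (ℝ × ℝ))))
    (hgc : ContinuousOn (fun p : ℝ × ℝ × ℝ => g p.1 p.2.1 p.2.2)
      (Icc 0 1 ×ˢ (univ : Set (ℝ × ℝ))))
    (L₁ L₂ : ℝ) (hL₁ : 0 < L₁) (hL₂ : 0 < L₂)
    (hflip : ∀ t ∈ Icc (0:ℝ) 1, ∀ x₁ y₁ x₂ y₂ : ℝ,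
      |f t x₁ y₁ - f t x₂ y₂| ≤ L₁ * (|x₁ - x₂| + |y₁ - y₂|))
    (hglip : ∀ t ∈ Icc (0:ℝ) 1, ∀ x₁ y₁ x₂ y₂ : ℝ,
      |g t x₁ y₁ - g t x₂ y₂| ≤ L₂ * (|x₁ - x₂| + |y₁ - y₂|))
    (γ₃ γ₄ : ℝ)
    (hγ₃ : γ₃ = (L₁ / Real.Gamma (α + 1)) *
      ((ψ 1 - ψ 0) ^ α + ((lam + 1) / |Δ₁|) * (ψ 1 - ψ 0) ^ (α + 1)))
    (hγ₄ : γ₄ = (L₂ / Real.Gamma (β + 1)) *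
      ((ψ 1 - ψ 0) ^ β + ((μ + 1) / |Δ₂|) * (ψ 1 - ψ 0) ^ (β + 1)))
    (hcontr : γ₃ + γ₄ < 1) :
    ∃ x y : ℝ → ℝ,
      (ContinuousOn x (Icc 0 1) ∧ ContinuousOn y (Icc 0 1) ∧
        ∀ t ∈ Icc (0:ℝ) 1,
          x t = Tmap ψ α η lam Δ₁ f x y t ∧ y t = Tmap ψ β ξ μ Δ₂ g x y t) ∧
      ∀ x' y' : ℝ → ℝ,
        (ContinuousOn x' (Icc 0 1) ∧ ContinuousOn y' (Icc 0 1) ∧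
          ∀ t ∈ Icc (0:ℝ) 1,
            x' t = Tmap ψ α η lam Δ₁ f x' y' t ∧ y' t = Tmap ψ β ξ μ Δ₂ g x' y' t) →
        EqOn x x' (Icc 0 1) ∧ EqOn y y' (Icc 0 1) := by
  subst hγ₃ hγ₄
  have hηI : η ∈ Icc (0:ℝ) 1 := ⟨hη0.le, hη1.le⟩
  have hξI : ξ ∈ Icc (0:ℝ) 1 := ⟨hξ0.le, hξ1.le⟩
  obtain ⟨c₁, hc₁⟩ : ∃ c, c = (L₁ / Real.Gamma (α + 1)) *
      ((ψ 1 - ψ 0) ^ α + ((lam + 1) / |Δ₁|) * (ψ 1 - ψ 0) ^ (α + 1)) := ⟨_, rfl⟩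
  obtain ⟨c₂, hc₂⟩ : ∃ c, c = (L₂ / Real.Gamma (β + 1)) *
      ((ψ 1 - ψ 0) ^ β + ((μ + 1) / |Δ₂|) * (ψ 1 - ψ 0) ^ (β + 1)) := ⟨_, rfl⟩
  rw [← hc₁, ← hc₂] at hcontr
  have hψ01 : 0 < ψ 1 - ψ 0 := sub_pos.2 (hψmono (by simp) (by simp) one_pos)
  have hc₁0 : 0 ≤ c₁ := by
    have := Real.Gamma_pos_of_pos (show 0 < α + 1 by linarith)
    rw [hc₁]; positivity
  have hc₂0 : 0 ≤ c₂ := by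
    have := Real.Gamma_pos_of_pos (show 0 < β + 1 by linarith)
    rw [hc₂]; positivity
  let ext : C(Icc (0:ℝ) 1, ℝ) → ℝ → ℝ := fun u => IccExtend zero_le_one u
  have hext : ∀ u, ContinuousOn (ext u) (Icc 0 1) := fun u =>
    (u.continuous.Icc_extend').continuousOn
  have hext_apply : ∀ u (t : Icc (0:ℝ) 1), ext u t = u t := fun u t => by simp [ext]
  let E := WithLp 1 (C(Icc (0:ℝ) 1, ℝ) × C(Icc (0:ℝ) 1, ℝ))
  let T : E → E := fun z => WithLp.toLp 1
    (⟨_, (continuousOn_Tmap (η := η) (lam := lam) (Δ := Δ₁) hψC1 hψ' hα1 hfc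
        (hext z.fst) (hext z.snd)).domRestrict⟩,
      ⟨_, (continuousOn_Tmap (η := ξ) (lam := μ) (Δ := Δ₂) hψC1 hψ' hβ1 hgc
        (hext z.fst) (hext z.snd)).domRestrict⟩)
  have hT₁ : ∀ z t, (T z).fst t = Tmap ψ α η lam Δ₁ f (ext z.fst) (ext z.snd) t := fun _ _ => rfl
  have hT₂ : ∀ z t, (T z).snd t = Tmap ψ β ξ μ Δ₂ g (ext z.fst) (ext z.snd) t := fun _ _ => rfl
  have hdist : ∀ z w : E, dist z w = dist z.fst w.fst + dist z.snd w.snd := fun z w => by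
    rw [WithLp.prod_dist_eq_add (by simp)]; simp
  have hT : ContractingWith (c₁ + c₂).toNNReal T := by
    refine ⟨by simpa [← NNReal.coe_lt_coe, add_nonneg hc₁0 hc₂0] using hcontr,
      LipschitzWith.of_dist_le_mul fun z w => ?_⟩
    have hD : ∀ s ∈ Icc (0:ℝ) 1, |ext z.fst s - ext w.fst s| + |ext z.snd s - ext w.snd s| ≤
        dist z w := fun s hs => by
      have e := fun u => hext_apply u ⟨s, hs⟩
      simp only at e
      rw [e, e, e, e, hdist, ← Real.dist_eq, ← Real.dist_eq]
      exact add_le_add (ContinuousMap.dist_apply_le_dist _) (ContinuousMap.dist_apply_le_dist _)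
    rw [Real.coe_toNNReal _ (add_nonneg hc₁0 hc₂0), hdist (T z), add_mul]
    refine add_le_add ?_ ?_
    · refine (ContinuousMap.dist_le (by positivity)).2 fun t => ?_
      rw [hT₁, hT₁, Real.dist_eq, hc₁]
      exact abs_Tmap_sub_le hψmono hψC1 hψ' hα1 hηI hlam hfc hL₁ hflip (hext _) (hext _)
        (hext _) (hext _) hD t.2
    · refine (ContinuousMap.dist_le (by positivity)).2 fun t => ?_
      rw [hT₂, hT₂, Real.dist_eq, hc₂]
      exact abs_Tmap_sub_le hψmono hψC1 hψ' hβ1 hξI hμ hgc hL₂ hglip (hext _) (hext _)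
        (hext _) (hext _) hD t.2
  obtain ⟨z, hz⟩ : ∃ z, T z = z := ⟨_, hT.fixedPoint_isFixedPt⟩
  refine ⟨ext z.fst, ext z.snd, ⟨hext _, hext _, fun t ht => ⟨?_, ?_⟩⟩, ?_⟩
  · rw [← hT₁ z ⟨t, ht⟩, hz]
    exact hext_apply _ ⟨t, ht⟩
  · rw [← hT₂ z ⟨t, ht⟩, hz]
    exact hext_apply _ ⟨t, ht⟩
  · rintro x' y' ⟨hx', hy', hfix⟩
    let w : E := WithLp.toLp 1 (⟨_, hx'.domRestrict⟩, ⟨_, hy'.domRestrict⟩)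
    have hwx : EqOn (ext w.fst) x' (Icc 0 1) := fun t ht => hext_apply w.fst ⟨t, ht⟩
    have hwy : EqOn (ext w.snd) y' (Icc 0 1) := fun t ht => hext_apply w.snd ⟨t, ht⟩
    have hw : T w = w := by
      refine WithLp.ofLp_injective 1 (Prod.ext (ContinuousMap.ext fun t => ?_)
        (ContinuousMap.ext fun t => ?_))
      · exact (Tmap_congr hηI hwx hwy t.2).trans (hfix t t.2).1.symm
      · exact (Tmap_congr hξI hwx hwy t.2).trans (hfix t t.2).2.symm
    rw [hT.fixedPoint_unique' hz hw]
    exact ⟨hwx, hwy⟩
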